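/- Let Ω' with relations S'_0,...,S'_4 be an association scheme whose intersection numbers coincide with those of the 4-class fusion scheme of the flag scheme of a generalized quadrangle of order (s,s), s ≥ 1. Let C = {x_0, x_1, ..., x_s} be a (maximal S'_1-)clique and, for each i, let C'_i be the clique containing x_i other than C. Then the cliques C'_0, C'_1, ..., C'_s are pairwise disjoint. -/

import Mathlib

section Defs

variable {P L : Type*}

/-- Two distinct points are collinear if some line is incident with both. -/
def Collin (I : P → L → Prop) (p q : P) : Prop :=
  p ≠ q ∧ ∃ N : L, I p N ∧ I q N

/-- A finite generalized quadrangle of order `(s,t)` with point set `P`,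
line set `L` and incidence relation `I`. -/
structure IsGQ (s t : ℕ) (P L : Type*) (I : P → L → Prop) : Prop where
  nonemptyP : Nonempty P
  nonemptyL : Nonempty L
  finP : Finite P
  finL : Finite L
  lines_through : ∀ p : P, Nat.card {l : L // I p l} = t + 1
  points_on : ∀ l : L, Nat.card {p : P // I p l} = s + 1
  unique_line : ∀ p q : P, p ≠ q → ∀ l m : L, I p l → I q l → I p m → I q m → l = m
  unique_point : ∀ l m : L, l ≠ m → ∀ p q : P, I p l → I p m → I q l → I q m → p = q
  gq3 : ∀ (p : P) (l : L), ¬ I p l →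
    ∃! qM : P × L, I p qM.2 ∧ I qM.1 qM.2 ∧ I qM.1 l

/-- The set of flags (incident point–line pairs). -/
def GQFlag (I : P → L → Prop) : Type _ := {x : P × L // I x.1 x.2}

/-- The relations `R_0, …, R_7` on the set of flags.  For a flag `x = (p,L)` and
a flag `y = (q,M)`:
`R_0`: the diagonal; `R_1`: `p = q`, `L ≠ M`; `R_2`: `L = M`, `p ≠ q`;
`R_3`: `p ≠ q`, `L ≠ M`, `q` incident with `L`;
`R_4`: `p ≠ q`, `L ≠ M`, `p` incident with `M`;
`R_5`: `p ≠ q` collinear on a line different from both `L` and `M`;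
`R_6`: `L ≠ M` meet in a point `r` with `r ≠ p`, `r ≠ q`;
`R_7`: `L` and `M` have no common point and `p`, `q` are not collinear. -/
def Rrel (I : P → L → Prop) : ℕ → GQFlag I → GQFlag I → Prop
  | 0 => fun x y => x = y
  | 1 => fun x y => x.1.1 = y.1.1 ∧ x.1.2 ≠ y.1.2
  | 2 => fun x y => x.1.2 = y.1.2 ∧ x.1.1 ≠ y.1.1
  | 3 => fun x y => x.1.1 ≠ y.1.1 ∧ x.1.2 ≠ y.1.2 ∧ I y.1.1 x.1.2
  | 4 => fun x y => x.1.1 ≠ y.1.1 ∧ x.1.2 ≠ y.1.2 ∧ I x.1.1 y.1.2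
  | 5 => fun x y => x.1.1 ≠ y.1.1 ∧ ∃ N : L, I x.1.1 N ∧ I y.1.1 N ∧ N ≠ x.1.2 ∧ N ≠ y.1.2
  | 6 => fun x y => x.1.2 ≠ y.1.2 ∧ ∃ r : P, I r x.1.2 ∧ I r y.1.2 ∧ r ≠ x.1.1 ∧ r ≠ y.1.1
  | 7 => fun x y => (∀ r : P, ¬ (I r x.1.2 ∧ I r y.1.2)) ∧ ¬ Collin I x.1.1 y.1.1
  | _ => fun _ _ => False

/-- `Ncount I i j x y` is the number of flags `z` with `(x,z) ∈ R_i` and `(z,y) ∈ R_j`. -/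
noncomputable def Ncount (I : P → L → Prop) (i j : ℕ) (x y : GQFlag I) : ℕ :=
  Nat.card {z : GQFlag I // Rrel I i x z ∧ Rrel I j z y}

/-- The fused relations `S_0 = R_0`, `S_1 = R_1 ∪ R_2`, `S_2 = R_3 ∪ R_4`,
`S_3 = R_5 ∪ R_6`, `S_4 = R_7`. -/
def Srel (I : P → L → Prop) : ℕ → GQFlag I → GQFlag I → Prop
  | 0 => fun x y => Rrel I 0 x y
  | 1 => fun x y => Rrel I 1 x y ∨ Rrel I 2 x y
  | 2 => fun x y => Rrel I 3 x y ∨ Rrel I 4 x y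
  | 3 => fun x y => Rrel I 5 x y ∨ Rrel I 6 x y
  | 4 => fun x y => Rrel I 7 x y
  | _ => fun _ _ => False

/-- `Mcount I i j x y` is the number of flags `z` with `(x,z) ∈ S_i` and `(z,y) ∈ S_j`. -/
noncomputable def Mcount (I : P → L → Prop) (i j : ℕ) (x y : GQFlag I) : ℕ :=
  Nat.card {z : GQFlag I // Srel I i x z ∧ Srel I j z y}

end Defs

/-- `C` is a maximal clique of the graph with adjacency relation `rel`. -/
def IsMaxClique {α : Type*} (rel : α → α → Prop) (C : Set α) : Prop :=
  (∀ y ∈ C, ∀ z ∈ C, y ≠ z → rel y z) ∧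
  ∀ D : Set α, C ⊆ D → (∀ y ∈ D, ∀ z ∈ D, y ≠ z → rel y z) → D = C

/-- The point-clique through `x`: `{x} ∪ {z | (x,z) ∈ R_1}`. -/
def PC {α : Type*} (rel : ℕ → α → α → Prop) (x : α) : Set α :=
  insert x {z | rel 1 x z}

/-- The line-clique through `x`: `{x} ∪ {z | (x,z) ∈ R_2}`. -/
def LC {α : Type*} (rel : ℕ → α → α → Prop) (x : α) : Set α :=
  insert x {z | rel 2 x z}

section Cliques

variable {α : Type*} {rel : α → α → Prop}

/-- A vertex adjacent to two vertices of a maximal clique belongs to that clique, provided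
distinct nonadjacent vertices have at most one common neighbour. -/
theorem IsMaxClique.mem_of_rel_of_rel (hsymm : ∀ a b, rel a b → rel b a)
    (hone : ∀ a b, a ≠ b → ¬ rel a b → ∀ c d, rel a c → rel c b → rel a d → rel d b → c = d)
    {C : Set α} (hC : IsMaxClique rel C) {x y z : α} (hx : x ∈ C) (hy : y ∈ C) (hxy : x ≠ y)
    (hzx : rel z x) (hzy : rel z y) : z ∈ C := by
  have hz : ∀ c ∈ C, z ≠ c → rel z c := by
    intro c hc hzc
    by_contra hn
    by_cases hcx : x = c
    · exact hn (hcx ▸ hzx)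
    by_cases hcy : y = c
    · exact hn (hcy ▸ hzy)
    exact hxy (hone z c hzc hn x y hzx (hC.1 x hx c hc hcx) hzy (hC.1 y hy c hc hcy))
  have hins : insert z C = C := by
    refine hC.2 _ (Set.subset_insert z C) ?_
    rintro a (rfl | ha) b (rfl | hb) hab
    · exact absurd rfl hab
    · exact hz b hb hab
    · exact hsymm _ _ (hz a ha hab.symm)
    · exact hC.1 a ha b hb hab
  exact hins ▸ Set.mem_insert z C

/-- Maximal cliques with two common vertices coincide, provided distinct nonadjacent vertices
have at most one common neighbour. -/
theorem IsMaxClique.eq_of_two_mem (hsymm : ∀ a b, rel a b → rel b a)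
    (hone : ∀ a b, a ≠ b → ¬ rel a b → ∀ c d, rel a c → rel c b → rel a d → rel d b → c = d)
    {C D : Set α} (hC : IsMaxClique rel C) (hD : IsMaxClique rel D) {x y : α} (hxy : x ≠ y)
    (hxC : x ∈ C) (hyC : y ∈ C) (hxD : x ∈ D) (hyD : y ∈ D) : D = C := by
  refine (hD.2 C (fun d hd => ?_) hC.1).symm
  by_cases hdx : d = x
  · exact hdx ▸ hxC
  by_cases hdy : d = y
  · exact hdy ▸ hyC
  exact hC.mem_of_rel_of_rel hsymm hone hxC hyC hxy (hD.1 d hd x hxD hdx) (hD.1 d hd y hyD hdy)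

end Cliques

section Flags

variable {P L : Type*} {I : P → L → Prop} {s t : ℕ}

theorem IsGQ.nonempty_flag (h : IsGQ s t P L I) : Nonempty (GQFlag I) := by
  obtain ⟨p⟩ := h.nonemptyP
  have hne : Nonempty {l : L // I p l} :=
    (Nat.card_pos_iff.1 (by rw [h.lines_through p]; omega)).1
  obtain ⟨l, hl⟩ := hne
  exact ⟨⟨(p, l), hl⟩⟩

/-- Two flags sharing their point or their line are in none of `S_2`, `S_3`, `S_4`. -/
theorem IsGQ.not_srel_of_point_eq_or_line_eq (h : IsGQ s t P L I) {u v : GQFlag I}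
    (huv : u.1.1 = v.1.1 ∨ u.1.2 = v.1.2) {k : ℕ} (hk : 2 ≤ k) : ¬ Srel I k u v := by
  obtain ⟨⟨p, l⟩, hpl⟩ := u
  obtain ⟨⟨q, m⟩, hqm⟩ := v
  dsimp only at huv hpl hqm
  intro hS
  match k, hk, hS with
  | 2, _, hS =>
    simp only [Srel, Rrel] at hS
    tauto
  | 3, _, hS =>
    simp only [Srel, Rrel] at hS
    rcases hS with ⟨hpq, N, hpN, hqN, hNl, -⟩ | ⟨hlm, r, hrl, hrm, hrp, -⟩
    · obtain rfl := huv.resolve_left hpq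
      exact hNl (h.unique_line p q hpq N l hpN hqN hpl hqm)
    · obtain rfl := huv.resolve_right hlm
      exact hrp (h.unique_point l m hlm r p hrl hrm hpl hqm)
  | 4, _, hS =>
    simp only [Srel, Rrel] at hS
    rcases huv with rfl | rfl
    · exact hS.1 p ⟨hpl, hqm⟩
    · exact hS.1 p ⟨hpl, hpl⟩

/-- Flags in relation `S_2`, `S_3` or `S_4` have at most one common `S_1`-neighbour. -/
theorem IsGQ.eq_of_srel_one (h : IsGQ s t P L I) {u v w w' : GQFlag I} {k : ℕ} (hk : 2 ≤ k)
    (huv : Srel I k u v) (huw : Srel I 1 u w) (hwv : Srel I 1 w v)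
    (huw' : Srel I 1 u w') (hwv' : Srel I 1 w' v) : w = w' := by
  have hne : ¬ (u.1.1 = v.1.1 ∨ u.1.2 = v.1.2) :=
    fun he => h.not_srel_of_point_eq_or_line_eq he hk huv
  have key : u.1.1 ≠ v.1.1 → I u.1.1 v.1.2 → I v.1.1 u.1.2 → u.1.2 = v.1.2 :=
    fun hp h1 h2 => h.unique_line _ _ hp _ _ u.2 h2 h1 v.2
  obtain ⟨⟨p, l⟩, hpl⟩ := u
  obtain ⟨⟨q, m⟩, hqm⟩ := v
  obtain ⟨⟨a, b⟩, hab⟩ := w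
  obtain ⟨⟨c, d⟩, hcd⟩ := w'
  simp only [Srel, Rrel] at *
  have hacbd : a = c ∧ b = d := by grind
  obtain ⟨rfl, rfl⟩ := hacbd
  rfl

end Flags

/-- if `C` is a maximal `S'_1`-clique and, for distinct vertices
`x, x'` of `C`, `D` and `D'` are the cliques through `x` resp. `x'` other than
`C`, then `D` and `D'` are disjoint. -/
theorem stmt_18 {s : ℕ} (hs : 1 ≤ s)
    {Ω' : Type*} (S' : ℕ → Ω' → Ω' → Prop)
    (hfin : Finite Ω')
    (hpart : ∀ x y : Ω', ∃! l : ℕ, l < 5 ∧ S' l x y)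
    (hdiag : ∀ x y : Ω', S' 0 x y ↔ x = y)
    (hsymm : ∀ l : ℕ, l < 5 → ∀ x y : Ω', S' l x y ↔ S' l y x)
    {P L : Type*} (I : P → L → Prop) (hGQ : IsGQ s s P L I)
    (hinter : ∀ i j k : ℕ, i < 5 → j < 5 → k < 5 →
      ∀ x y : Ω', S' k x y → ∀ u v : GQFlag I, Srel I k u v →
        Nat.card {z : Ω' // S' i x z ∧ S' j z y} =
        Nat.card {w : GQFlag I // Srel I i u w ∧ Srel I j w v})
    (C : Set Ω') (hC : IsMaxClique (S' 1) C) :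
    ∀ x ∈ C, ∀ x' ∈ C, x ≠ x' →
      ∀ D D' : Set Ω',
        IsMaxClique (S' 1) D → x ∈ D → D ≠ C →
        IsMaxClique (S' 1) D' → x' ∈ D' → D' ≠ C →
        D ∩ D' = ∅ := by
  have hsymm' : ∀ a b, S' 1 a b → S' 1 b a := fun a b => (hsymm 1 (by norm_num) a b).1
  have hone : ∀ a b, a ≠ b → ¬ S' 1 a b →
      ∀ c d, S' 1 a c → S' 1 c b → S' 1 a d → S' 1 d b → c = d := by
    intro a b hab hnab c d hac hcb had hdb
    obtain ⟨k, ⟨hk, hkab⟩, -⟩ := hpart a b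
    have hk0 : k ≠ 0 := by
      rintro rfl
      exact hab ((hdiag a b).1 hkab)
    have hk1 : k ≠ 1 := by
      rintro rfl
      exact hnab hkab
    obtain ⟨u⟩ := hGQ.nonempty_flag
    -- `S_k` is nonempty since its valency at `u` equals that of `S'_k` at `a`.
    have hval := hinter k k 0 hk hk (by norm_num) a a ((hdiag a a).2 rfl) u u rfl
    have : Nonempty {z : Ω' // S' k a z ∧ S' k z a} := ⟨⟨b, hkab, (hsymm k hk a b).1 hkab⟩⟩
    obtain ⟨⟨v, huv, -⟩⟩ := (Nat.card_pos_iff.1 (hval ▸ Nat.card_pos)).1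
    have hcount := hinter 1 1 k (by norm_num) (by norm_num) hk a b hkab u v huv
    have hsub : Subsingleton {w : GQFlag I // Srel I 1 u w ∧ Srel I 1 w v} :=
      ⟨fun w w' => Subtype.ext
        (hGQ.eq_of_srel_one (by omega) huv w.2.1 w.2.2 w'.2.1 w'.2.2)⟩
    have hsub' : Subsingleton {z : Ω' // S' 1 a z ∧ S' 1 z b} :=
      Finite.card_le_one_iff_subsingleton.1
        (hcount ▸ Finite.card_le_one_iff_subsingleton.2 hsub)
    exact congrArg Subtype.val (hsub'.elim ⟨c, hac, hcb⟩ ⟨d, had, hdb⟩)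
  intro x hx x' hx' hxx' D D' hD hxD hDC hD' hxD' hDC'
  refine Set.eq_empty_of_forall_notMem fun z ⟨hzD, hzD'⟩ => ?_
  by_cases hzx : z = x
  · subst hzx
    exact hDC' (hC.eq_of_two_mem hsymm' hone hD' hxx' hx hx' hzD' hxD')
  by_cases hzx' : z = x'
  · subst hzx'
    exact hDC (hC.eq_of_two_mem hsymm' hone hD hxx' hx hx' hxD hzD)
  have hzC : z ∈ C := hC.mem_of_rel_of_rel hsymm' hone hx hx' hxx'
    (hD.1 z hzD x hxD hzx) (hD'.1 z hzD' x' hxD' hzx')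
  exact hDC (hC.eq_of_two_mem hsymm' hone hD hzx hzC hx hzD hxD)
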